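/- For the natural representation of sl₂(ℂ) on the free Lie algebra L on a, b, the space of Lie invariants of degree 8 is one-dimensional, spanned by [[[[b,a],a],[b,a]],[[b,a],b]] − [[[[b,a],b],[b,a]],[[b,a],a]], which equals the bracket [I₂, I₆] = [[b,a], [[[b,a],b],[[b,a],a]]] of the invariants of degrees 2 and 6; consequently there are no primitive invariants in degree 8. -/

import Mathlib

/-!
Setting: the free Lie algebra `FL` over ℂ on two generators `a < b`, with the simple
Lie algebra sl₂(ℂ) (standard basis x, h, y, with ⁅h,x⁆ = 2x, ⁅h,y⁆ = −2y, ⁅x,y⁆ = h)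
acting on `FL` by derivations extending its natural representation on the span of the
generators:  x.a = 0, x.b = a, h.a = a, h.b = −b, y.a = b, y.b = 0.
The derivations `X H Y` realizing these actions are uniquely determined by their values
on the generators, so we quantify over derivations with the prescribed generator values.
-/

noncomputable section

/-- The free Lie algebra over ℂ on two generators. -/
abbrev FL : Type := FreeLieAlgebra ℂ (Fin 2)

/-- The generator `a`. -/
def genA : FL := FreeLieAlgebra.of ℂ 0

/-- The generator `b`. -/
def genB : FL := FreeLieAlgebra.of ℂ 1

/-- Interpret a nonassociative word on the generators as a Lie monomial in `FL`. -/
def magmaToLie : FreeMagma (Fin 2) → FL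
  | .of i => FreeLieAlgebra.of ℂ i
  | .mul t u => ⁅magmaToLie t, magmaToLie u⁆

/-- The homogeneous component `L_j`: the span of the Lie monomials of degree `j`. -/
def homog (j : ℕ) : Submodule ℂ FL :=
  Submodule.span ℂ (magmaToLie '' {t | t.length = j})

/-- The weight space `L_j^w`: the eigenspace of the `h`-action on `L_j`
with eigenvalue `w`. -/
def wtsp (H : LieDerivation ℂ FL FL) (j : ℕ) (w : ℤ) : Submodule ℂ FL :=
  homog j ⊓ Module.End.eigenspace (H.toLinearMap) (w : ℂ)

/-- The space of Lie invariants of degree `j`: elements of `L_j` annihilated by every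
element of sl₂(ℂ), equivalently by the actions of the basis elements x, h, y. -/
def invariants (X H Y : LieDerivation ℂ FL FL) (j : ℕ) : Submodule ℂ FL :=
  homog j ⊓ LinearMap.ker X.toLinearMap ⊓ LinearMap.ker H.toLinearMap ⊓
    LinearMap.ker Y.toLinearMap

/-- The Lie subalgebra of `FL` generated by the invariants of degree `< j`.
An invariant of degree `j` is primitive iff it does not belong to this subalgebra. -/
def lowerInv (X H Y : LieDerivation ℂ FL FL) (j : ℕ) : LieSubalgebra ℂ FL :=
  LieSubalgebra.lieSpan ℂ FL (⋃ i < j, (invariants X H Y i : Set FL))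

/-- `[b,a]` -/
def ba : FL := ⁅genB, genA⁆
/-- `[[b,a],a]` -/
def baa : FL := ⁅ba, genA⁆
/-- `[[b,a],b]` -/
def bab : FL := ⁅ba, genB⁆
/-- `[[[b,a],a],a]` -/
def baaa : FL := ⁅baa, genA⁆
/-- `[[[b,a],a],b]` -/
def baab : FL := ⁅baa, genB⁆
/-- `[[[b,a],b],b]` -/
def babb : FL := ⁅bab, genB⁆

/-- `[[[[b,a],a],[b,a]],[[b,a],b]] − [[[[b,a],b],[b,a]],[[b,a],a]]` -/
def E8 : FL := ⁅⁅baa, ba⁆, bab⁆ - ⁅⁅bab, ba⁆, baa⁆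



set_option linter.unusedSimpArgs false
set_option linter.unusedSectionVars false

namespace Deg8

section Relations

variable {L : Type*} [LieRing L] [LieAlgebra ℂ L]

theorem r22 (a b : L) : ⁅a, ⁅b, ⁅a, b⁆⁆⁆ = ⁅b, ⁅a, ⁅a, b⁆⁆⁆ := by
  have h := lie_self (⁅a, b⁆)
  rw [lie_lie, sub_eq_zero] at h
  exact h

theorem r24 (a b : L) : ⁅a, ⁅b, ⁅b, ⁅b, ⁅a, b⁆⁆⁆⁆⁆ =
    ((2 : ℂ)) • ⁅b, ⁅a, ⁅b, ⁅b, ⁅a, b⁆⁆⁆⁆⁆ + ((-1 : ℂ)) • ⁅b, ⁅b, ⁅b, ⁅a, ⁅a, b⁆⁆⁆⁆⁆ := by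
  have h := (lie_skew (⁅b, ⁅b, ⁅a, b⁆⁆⁆) (⁅a, b⁆)).symm
  simp only [lie_lie, lie_sub, sub_lie, lie_add, lie_smul, neg_sub, r22 a b] at h
  linear_combination (norm := module) (1/2 : ℂ) • h

theorem r42 (a b : L) : ⁅a, ⁅b, ⁅a, ⁅a, ⁅a, b⁆⁆⁆⁆⁆ =
    ((1/2 : ℂ)) • ⁅b, ⁅a, ⁅a, ⁅a, ⁅a, b⁆⁆⁆⁆⁆ + ((1/2 : ℂ)) • ⁅a, ⁅a, ⁅b, ⁅a, ⁅a, b⁆⁆⁆⁆⁆ := by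
  have h := (lie_skew (⁅a, ⁅a, ⁅a, b⁆⁆⁆) (⁅a, b⁆)).symm
  simp only [lie_lie, lie_sub, sub_lie, lie_add, lie_smul, neg_sub, r22 a b] at h
  linear_combination (norm := module) (1/4 : ℂ) • h

theorem r33 (a b : L) : ⁅a, ⁅b, ⁅b, ⁅a, ⁅a, b⁆⁆⁆⁆⁆ =
    ((1 : ℂ)) • ⁅b, ⁅a, ⁅b, ⁅a, ⁅a, b⁆⁆⁆⁆⁆ + ((-1/3 : ℂ)) • ⁅b, ⁅b, ⁅a, ⁅a, ⁅a, b⁆⁆⁆⁆⁆ + ((1/3 : ℂ)) • ⁅a, ⁅a, ⁅b, ⁅b, ⁅a, b⁆⁆⁆⁆⁆ := by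
  have h := (lie_skew (⁅b, ⁅a, ⁅a, b⁆⁆⁆) (⁅a, b⁆)).symm
  simp only [lie_lie, lie_sub, sub_lie, lie_add, lie_smul, neg_sub, r22 a b] at h
  linear_combination (norm := module) (1/3 : ℂ) • h

theorem r44a (a b : L) : ⁅a, ⁅b, ⁅b, ⁅b, ⁅a, ⁅a, ⁅a, b⁆⁆⁆⁆⁆⁆⁆ =
    ((-9/4 : ℂ)) • ⁅b, ⁅a, ⁅b, ⁅a, ⁅b, ⁅a, ⁅a, b⁆⁆⁆⁆⁆⁆⁆ + ((3/4 : ℂ)) • ⁅b, ⁅a, ⁅b, ⁅b, ⁅a, ⁅a, ⁅a, b⁆⁆⁆⁆⁆⁆⁆ + ((1/4 : ℂ)) • ⁅b, ⁅a, ⁅a, ⁅a, ⁅b, ⁅b, ⁅a, b⁆⁆⁆⁆⁆⁆⁆ + ((-1/8 : ℂ)) • ⁅b, ⁅b, ⁅b, ⁅a, ⁅a, ⁅a, ⁅a, b⁆⁆⁆⁆⁆⁆⁆ + ((3/4 : ℂ)) • ⁅b, ⁅b, ⁅a, ⁅a, ⁅b, ⁅a, ⁅a, b⁆⁆⁆⁆⁆⁆⁆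 + ((1/4 : ℂ)) • ⁅a, ⁅a, ⁅b, ⁅a, ⁅b, ⁅b, ⁅a, b⁆⁆⁆⁆⁆⁆⁆ + ((-7/8 : ℂ)) • ⁅a, ⁅a, ⁅b, ⁅b, ⁅b, ⁅a, ⁅a, b⁆⁆⁆⁆⁆⁆⁆ + ((9/4 : ℂ)) • ⁅a, ⁅b, ⁅b, ⁅a, ⁅b, ⁅a, ⁅a, b⁆⁆⁆⁆⁆⁆⁆ := by
  have h := (lie_skew (⁅b, ⁅a, ⁅b, ⁅a, ⁅a, b⁆⁆⁆⁆⁆) (⁅a, b⁆)).symm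
  simp only [lie_lie, lie_sub, sub_lie, lie_add, lie_smul, neg_sub, r22 a b, r24 a b, r42 a b, r33 a b] at h
  have k := (lie_skew (⁅b, ⁅b, ⁅a, ⁅a, ⁅a, b⁆⁆⁆⁆⁆) (⁅a, b⁆)).symm
  simp only [lie_lie, lie_sub, sub_lie, lie_add, lie_smul, neg_sub, r22 a b, r24 a b, r42 a b, r33 a b] at k
  linear_combination (norm := module) (1/4 : ℂ) • k - (9/16 : ℂ) • h

theorem r44b (a b : L) : ⁅a, ⁅b, ⁅a, ⁅a, ⁅b, ⁅b, ⁅a, b⁆⁆⁆⁆⁆⁆⁆ =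
    ((3/4 : ℂ)) • ⁅b, ⁅a, ⁅b, ⁅a, ⁅b, ⁅a, ⁅a, b⁆⁆⁆⁆⁆⁆⁆ + ((3/4 : ℂ)) • ⁅b, ⁅a, ⁅b, ⁅b, ⁅a, ⁅a, ⁅a, b⁆⁆⁆⁆⁆⁆⁆ + ((1/4 : ℂ)) • ⁅b, ⁅a, ⁅a, ⁅a, ⁅b, ⁅b, ⁅a, b⁆⁆⁆⁆⁆⁆⁆ + ((-1/8 : ℂ)) • ⁅b, ⁅b, ⁅b, ⁅a, ⁅a, ⁅a, ⁅a, b⁆⁆⁆⁆⁆⁆⁆ + ((-3/4 : ℂ)) • ⁅b, ⁅b, ⁅a, ⁅a, ⁅b, ⁅a, ⁅a, b⁆⁆⁆⁆⁆⁆⁆ + ((1/4 : ℂ)) • ⁅a, ⁅a, ⁅b, ⁅a, ⁅b, ⁅b, ⁅a, b⁆⁆⁆⁆⁆⁆⁆ + ((5/8 : ℂ)) • ⁅a, ⁅a, ⁅b, ⁅b, ⁅b, ⁅a, ⁅a, b⁆⁆⁆⁆⁆⁆⁆ + ((-3/4 : ℂ)) • ⁅a, ⁅b, ⁅b, ⁅a,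 ⁅b, ⁅a, ⁅a, b⁆⁆⁆⁆⁆⁆⁆ := by
  have h := (lie_skew (⁅b, ⁅a, ⁅b, ⁅a, ⁅a, b⁆⁆⁆⁆⁆) (⁅a, b⁆)).symm
  simp only [lie_lie, lie_sub, sub_lie, lie_add, lie_smul, neg_sub, r22 a b, r24 a b, r42 a b, r33 a b] at h
  have k := (lie_skew (⁅b, ⁅b, ⁅a, ⁅a, ⁅a, b⁆⁆⁆⁆⁆) (⁅a, b⁆)).symm
  simp only [lie_lie, lie_sub, sub_lie, lie_add, lie_smul, neg_sub, r22 a b, r24 a b, r42 a b, r33 a b] at k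
  linear_combination (norm := module) (1/4 : ℂ) • k + (3/16 : ℂ) • h

theorem e8_expand (a b : L) :
    ⁅⁅b, a⁆, ⁅⁅⁅b, a⁆, b⁆, ⁅⁅b, a⁆, a⁆⁆⁆ =
    ((-1/4 : ℂ)) • ⁅b, ⁅a, ⁅b, ⁅a, ⁅b, ⁅a, ⁅a, b⁆⁆⁆⁆⁆⁆⁆ + ((1/12 : ℂ)) • ⁅b, ⁅a, ⁅b, ⁅b, ⁅a, ⁅a, ⁅a, b⁆⁆⁆⁆⁆⁆⁆ + ((-1/12 : ℂ)) • ⁅b, ⁅a, ⁅a, ⁅a, ⁅b, ⁅b, ⁅a, b⁆⁆⁆⁆⁆⁆⁆ + ((-1/8 : ℂ)) • ⁅b, ⁅b, ⁅b, ⁅a, ⁅a, ⁅a, ⁅a, b⁆⁆⁆⁆⁆⁆⁆ + ((1/4 : ℂ)) • ⁅b, ⁅b, ⁅a, ⁅a, ⁅b, ⁅a, ⁅a, b⁆⁆⁆⁆⁆⁆⁆ + ((1/4 : ℂ)) • ⁅a, ⁅a, ⁅b, ⁅a, ⁅b, ⁅b, ⁅a, b⁆⁆⁆⁆⁆⁆⁆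 + ((-3/8 : ℂ)) • ⁅a, ⁅a, ⁅b, ⁅b, ⁅b, ⁅a, ⁅a, b⁆⁆⁆⁆⁆⁆⁆ + ((1/4 : ℂ)) • ⁅a, ⁅b, ⁅b, ⁅a, ⁅b, ⁅a, ⁅a, b⁆⁆⁆⁆⁆⁆⁆ := by
  have h1 : ⁅⁅b, a⁆, b⁆ = ⁅b, ⁅a, b⁆⁆ := by rw [← lie_skew a b, lie_neg, lie_skew]
  have h2 : ⁅⁅b, a⁆, a⁆ = ⁅a, ⁅a, b⁆⁆ := by rw [← lie_skew a b, lie_neg, lie_skew]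
  rw [h1, h2, ← lie_skew b a]
  simp only [neg_lie, lie_lie, lie_sub, sub_lie, lie_add, lie_smul, r22 a b, r24 a b, r42 a b, r33 a b, r44a a b, r44b a b]
  module

theorem e8_bracket (c u v : L) : ⁅⁅u, c⁆, v⁆ - ⁅⁅v, c⁆, u⁆ = ⁅c, ⁅v, u⁆⁆ := by
  rw [leibniz_lie c v u, ← lie_skew c u, ← lie_skew c v, neg_lie, lie_neg, lie_skew ⁅u, c⁆ v]
  abel

end Relations

section Spanning

/-- Span of the right-normed words with `p` letters `a` and `q` letters `b`. -/
def S : ℕ → ℕ → Submodule ℂ FL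
  | 0, 0 => ⊥
  | 1, 0 => Submodule.span ℂ {genA}
  | 0, 1 => Submodule.span ℂ {genB}
  | _ + 2, 0 => ⊥
  | 0, _ + 2 => ⊥
  | p + 1, q + 1 =>
    (S p (q + 1)).map (LieAlgebra.ad ℂ FL genA) ⊔ (S (p + 1) q).map (LieAlgebra.ad ℂ FL genB)

theorem S_succ (p q : ℕ) : S (p + 1) (q + 1) =
    (S p (q + 1)).map (LieAlgebra.ad ℂ FL genA) ⊔
      (S (p + 1) q).map (LieAlgebra.ad ℂ FL genB) := by
  rw [S]

theorem S_adA (p q : ℕ) (z : FL) (hz : z ∈ S p q) : ⁅genA, z⁆ ∈ S (p + 1) q := by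
  match p, q with
  | 0, 0 =>
    rw [S, Submodule.mem_bot] at hz
    simp [hz]
  | 1, 0 =>
    rw [S, Submodule.mem_span_singleton] at hz
    obtain ⟨c, rfl⟩ := hz
    simp
  | p + 2, 0 =>
    rw [S, Submodule.mem_bot] at hz
    simp [hz]
  | p, q + 1 =>
    rw [S_succ]
    exact Submodule.mem_sup_left ⟨z, hz, rfl⟩

theorem S_adB (p q : ℕ) (z : FL) (hz : z ∈ S p q) : ⁅genB, z⁆ ∈ S p (q + 1) := by
  match p, q with
  | 0, 0 =>
    rw [S, Submodule.mem_bot] at hz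
    simp [hz]
  | 0, 1 =>
    rw [S, Submodule.mem_span_singleton] at hz
    obtain ⟨c, rfl⟩ := hz
    simp
  | 0, q + 2 =>
    rw [S, Submodule.mem_bot] at hz
    simp [hz]
  | p + 1, q =>
    rw [S_succ]
    exact Submodule.mem_sup_right ⟨z, hz, rfl⟩

/-- Number of letters `a` in a nonassociative word. -/
def ca : FreeMagma (Fin 2) → ℕ
  | .of i => if i = 0 then 1 else 0
  | .mul t u => ca t + ca u

/-- Number of letters `b` in a nonassociative word. -/
def cb : FreeMagma (Fin 2) → ℕ
  | .of i => if i = 0 then 0 else 1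
  | .mul t u => cb t + cb u

theorem ca_add_cb (t : FreeMagma (Fin 2)) : ca t + cb t = t.length := by
  induction t using FreeMagma.rec with
  | of i => fin_cases i <;> rfl
  | mul t u ht hu =>
    have h : (t.mul u).length = t.length + u.length := rfl
    rw [h, ca, cb]
    lia

theorem S_magma_lie (t : FreeMagma (Fin 2)) : ∀ (p q : ℕ) (z : FL), z ∈ S p q →
    ⁅magmaToLie t, z⁆ ∈ S (p + ca t) (q + cb t) := by
  induction t using FreeMagma.rec with
  | of i =>
    intro p q z hz
    fin_cases i
    · exact S_adA p q z hz
    · exact S_adB p q z hz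
  | mul t u ht hu =>
    intro p q z hz
    rw [magmaToLie, lie_lie, ca, cb]
    refine Submodule.sub_mem _ ?_ ?_
    · have h := ht _ _ _ (hu _ _ _ hz)
      rwa [add_assoc, add_assoc, add_comm (ca u), add_comm (cb u)] at h
    · have h := hu _ _ _ (ht _ _ _ hz)
      rwa [add_assoc, add_assoc] at h

theorem S_magma (t : FreeMagma (Fin 2)) : magmaToLie t ∈ S (ca t) (cb t) := by
  induction t using FreeMagma.rec with
  | of i =>
    fin_cases i
    · change genA ∈ S 1 0
      rw [S]
      exact Submodule.mem_span_singleton_self _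
    · change genB ∈ S 0 1
      rw [S]
      exact Submodule.mem_span_singleton_self _
  | mul t u ht hu =>
    have h := S_magma_lie t _ _ _ hu
    rw [add_comm (ca u), add_comm (cb u)] at h
    exact h

theorem S_eigen (H : LieDerivation ℂ FL FL) (hHa : H genA = genA) (hHb : H genB = -genB)
    (p q : ℕ) : ∀ z ∈ S p q, H z = ((p : ℂ) - q) • z := by
  induction p, q using S.induct with
  | case1 => intro z hz; rw [S, Submodule.mem_bot] at hz; simp [hz]
  | case2 =>
    intro z hz
    rw [S, Submodule.mem_span_singleton] at hz
    obtain ⟨c, rfl⟩ := hz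
    simp [hHa]
  | case3 =>
    intro z hz
    rw [S, Submodule.mem_span_singleton] at hz
    obtain ⟨c, rfl⟩ := hz
    simp [hHb]
  | case4 => intro z hz; rw [S, Submodule.mem_bot] at hz; simp [hz]
  | case5 => intro z hz; rw [S, Submodule.mem_bot] at hz; simp [hz]
  | case6 p q ih1 ih2 =>
    intro z hz
    rw [S_succ] at hz
    obtain ⟨_, ⟨u, hu, rfl⟩, _, ⟨v, hv, rfl⟩, rfl⟩ := Submodule.mem_sup.mp hz
    simp only [LieAlgebra.ad_apply, map_add, LieDerivation.apply_lie_eq_add, ih1 u hu, ih2 v hv,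
      hHa, hHb, lie_smul, neg_lie]
    push_cast
    module

theorem S_le {p q : ℕ} {s t : Set FL} {T : Submodule ℂ FL}
    (hs : S p (q + 1) ≤ Submodule.span ℂ s) (ht : S (p + 1) q ≤ Submodule.span ℂ t)
    (hsT : ∀ x ∈ s, ⁅genA, x⁆ ∈ T) (htT : ∀ x ∈ t, ⁅genB, x⁆ ∈ T) :
    S (p + 1) (q + 1) ≤ T := by
  rw [S_succ]
  refine sup_le ?_ ?_
  · refine (Submodule.map_mono hs).trans ?_
    rw [Submodule.map_span_le]
    exact hsT
  · refine (Submodule.map_mono ht).trans ?_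
    rw [Submodule.map_span_le]
    exact htT

theorem S_zero_left (q : ℕ) : S 0 (q + 2) ≤ Submodule.span ℂ ∅ := by
  rw [S]; exact bot_le

theorem S_zero_right (p : ℕ) : S (p + 2) 0 ≤ Submodule.span ℂ ∅ := by
  rw [S]; exact bot_le

theorem S_one_one : S 1 1 ≤ Submodule.span ℂ {⁅genA, genB⁆} := by
  refine S_le (s := {genB}) (t := {genA}) (by rw [S]) (by rw [S]) ?_ ?_
  · rintro x rfl
    exact Submodule.mem_span_singleton_self _
  · rintro x rfl
    rw [← lie_skew genB genA]
    exact (Submodule.span ℂ {⁅genA, genB⁆}).neg_mem (Submodule.mem_span_singleton_self _)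

theorem S_1_2 : S 1 2 ≤ Submodule.span ℂ {⁅genB, ⁅genA, genB⁆⁆} := by
  refine S_le (S_zero_left _) S_one_one ?_ ?_
  · simp
  · simp only [Set.mem_insert_iff, Set.mem_singleton_iff, forall_eq_or_imp, forall_eq]
    exact Submodule.subset_span (by simp)

theorem S_2_1 : S 2 1 ≤ Submodule.span ℂ {⁅genA, ⁅genA, genB⁆⁆} := by
  refine S_le S_one_one (S_zero_right _) ?_ ?_
  · simp only [Set.mem_insert_iff, Set.mem_singleton_iff, forall_eq_or_imp, forall_eq]
    exact Submodule.subset_span (by simp)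
  · simp

theorem S_1_3 : S 1 3 ≤ Submodule.span ℂ {⁅genB, ⁅genB, ⁅genA, genB⁆⁆⁆} := by
  refine S_le (S_zero_left _) S_1_2 ?_ ?_
  · simp
  · simp only [Set.mem_insert_iff, Set.mem_singleton_iff, forall_eq_or_imp, forall_eq]
    exact Submodule.subset_span (by simp)

theorem S_2_2 : S 2 2 ≤ Submodule.span ℂ {⁅genB, ⁅genA, ⁅genA, genB⁆⁆⁆} := by
  refine S_le S_1_2 S_2_1 ?_ ?_
  · simp only [Set.mem_insert_iff, Set.mem_singleton_iff, forall_eq_or_imp, forall_eq]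
    rw [r22]
    exact Submodule.subset_span (by simp)
  · simp only [Set.mem_insert_iff, Set.mem_singleton_iff, forall_eq_or_imp, forall_eq]
    exact Submodule.subset_span (by simp)

theorem S_3_1 : S 3 1 ≤ Submodule.span ℂ {⁅genA, ⁅genA, ⁅genA, genB⁆⁆⁆} := by
  refine S_le S_2_1 (S_zero_right _) ?_ ?_
  · simp only [Set.mem_insert_iff, Set.mem_singleton_iff, forall_eq_or_imp, forall_eq]
    exact Submodule.subset_span (by simp)
  · simp

theorem S_1_4 : S 1 4 ≤ Submodule.span ℂ {⁅genB, ⁅genB, ⁅genB, ⁅genA, genB⁆⁆⁆⁆} := by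
  refine S_le (S_zero_left _) S_1_3 ?_ ?_
  · simp
  · simp only [Set.mem_insert_iff, Set.mem_singleton_iff, forall_eq_or_imp, forall_eq]
    exact Submodule.subset_span (by simp)

theorem S_2_3 : S 2 3 ≤ Submodule.span ℂ {⁅genB, ⁅genB, ⁅genA, ⁅genA, genB⁆⁆⁆⁆,
    ⁅genA, ⁅genB, ⁅genB, ⁅genA, genB⁆⁆⁆⁆} := by
  refine S_le S_1_3 S_2_2 ?_ ?_
  · simp only [Set.mem_insert_iff, Set.mem_singleton_iff, forall_eq_or_imp, forall_eq]
    exact Submodule.subset_span (by simp)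
  · simp only [Set.mem_insert_iff, Set.mem_singleton_iff, forall_eq_or_imp, forall_eq]
    exact Submodule.subset_span (by simp)

theorem S_3_2 : S 3 2 ≤ Submodule.span ℂ {⁅genB, ⁅genA, ⁅genA, ⁅genA, genB⁆⁆⁆⁆,
    ⁅genA, ⁅genB, ⁅genA, ⁅genA, genB⁆⁆⁆⁆} := by
  refine S_le S_2_2 S_3_1 ?_ ?_
  · simp only [Set.mem_insert_iff, Set.mem_singleton_iff, forall_eq_or_imp, forall_eq]
    exact Submodule.subset_span (by simp)
  · simp only [Set.mem_insert_iff, Set.mem_singleton_iff, forall_eq_or_imp, forall_eq]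
    exact Submodule.subset_span (by simp)

theorem S_4_1 : S 4 1 ≤ Submodule.span ℂ {⁅genA, ⁅genA, ⁅genA, ⁅genA, genB⁆⁆⁆⁆} := by
  refine S_le S_3_1 (S_zero_right _) ?_ ?_
  · simp only [Set.mem_insert_iff, Set.mem_singleton_iff, forall_eq_or_imp, forall_eq]
    exact Submodule.subset_span (by simp)
  · simp

theorem S_2_4 : S 2 4 ≤ Submodule.span ℂ {⁅genB, ⁅genA, ⁅genB, ⁅genB, ⁅genA, genB⁆⁆⁆⁆⁆,
    ⁅genB, ⁅genB, ⁅genB, ⁅genA, ⁅genA, genB⁆⁆⁆⁆⁆} := by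
  refine S_le S_1_4 S_2_3 ?_ ?_
  · simp only [Set.mem_insert_iff, Set.mem_singleton_iff, forall_eq_or_imp, forall_eq]
    rw [r24]
    repeat' first | apply Submodule.add_mem | apply Submodule.smul_mem
    all_goals exact Submodule.subset_span (by simp)
  · simp only [Set.mem_insert_iff, Set.mem_singleton_iff, forall_eq_or_imp, forall_eq]
    refine ⟨?_, ?_⟩
    · exact Submodule.subset_span (by simp)
    · exact Submodule.subset_span (by simp)

theorem S_3_3 : S 3 3 ≤ Submodule.span ℂ {⁅genB, ⁅genA, ⁅genB, ⁅genA, ⁅genA, genB⁆⁆⁆⁆⁆,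
    ⁅genB, ⁅genB, ⁅genA, ⁅genA, ⁅genA, genB⁆⁆⁆⁆⁆,
    ⁅genA, ⁅genA, ⁅genB, ⁅genB, ⁅genA, genB⁆⁆⁆⁆⁆} := by
  refine S_le S_2_3 S_3_2 ?_ ?_
  · simp only [Set.mem_insert_iff, Set.mem_singleton_iff, forall_eq_or_imp, forall_eq]
    refine ⟨?_, ?_⟩
    · rw [r33]
      repeat' first | apply Submodule.add_mem | apply Submodule.smul_mem
      all_goals exact Submodule.subset_span (by simp)
    · exact Submodule.subset_span (by simp)
  · simp only [Set.mem_insert_iff, Set.mem_singleton_iff, forall_eq_or_imp, forall_eq]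
    refine ⟨?_, ?_⟩
    · exact Submodule.subset_span (by simp)
    · exact Submodule.subset_span (by simp)

theorem S_4_2 : S 4 2 ≤ Submodule.span ℂ {⁅genB, ⁅genA, ⁅genA, ⁅genA, ⁅genA, genB⁆⁆⁆⁆⁆,
    ⁅genA, ⁅genA, ⁅genB, ⁅genA, ⁅genA, genB⁆⁆⁆⁆⁆} := by
  refine S_le S_3_2 S_4_1 ?_ ?_
  · simp only [Set.mem_insert_iff, Set.mem_singleton_iff, forall_eq_or_imp, forall_eq]
    refine ⟨?_, ?_⟩
    · rw [r42]
      repeat' first | apply Submodule.add_mem | apply Submodule.smul_mem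
      all_goals exact Submodule.subset_span (by simp)
    · exact Submodule.subset_span (by simp)
  · simp only [Set.mem_insert_iff, Set.mem_singleton_iff, forall_eq_or_imp, forall_eq]
    exact Submodule.subset_span (by simp)

theorem S_3_4 : S 3 4 ≤ Submodule.span ℂ {⁅genB, ⁅genA, ⁅genA, ⁅genB, ⁅genB, ⁅genA, genB⁆⁆⁆⁆⁆⁆,
    ⁅genB, ⁅genB, ⁅genB, ⁅genA, ⁅genA, ⁅genA, genB⁆⁆⁆⁆⁆⁆,
    ⁅genB, ⁅genB, ⁅genA, ⁅genB, ⁅genA, ⁅genA, genB⁆⁆⁆⁆⁆⁆,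
    ⁅genA, ⁅genB, ⁅genB, ⁅genB, ⁅genA, ⁅genA, genB⁆⁆⁆⁆⁆⁆,
    ⁅genA, ⁅genB, ⁅genA, ⁅genB, ⁅genB, ⁅genA, genB⁆⁆⁆⁆⁆⁆} := by
  refine S_le S_2_4 S_3_3 ?_ ?_
  · simp only [Set.mem_insert_iff, Set.mem_singleton_iff, forall_eq_or_imp, forall_eq]
    refine ⟨?_, ?_⟩
    · exact Submodule.subset_span (by simp)
    · exact Submodule.subset_span (by simp)
  · simp only [Set.mem_insert_iff, Set.mem_singleton_iff, forall_eq_or_imp, forall_eq]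
    refine ⟨?_, ?_, ?_⟩
    · exact Submodule.subset_span (by simp)
    · exact Submodule.subset_span (by simp)
    · exact Submodule.subset_span (by simp)

theorem S_4_3 : S 4 3 ≤ Submodule.span ℂ {⁅genB, ⁅genA, ⁅genA, ⁅genB, ⁅genA, ⁅genA, genB⁆⁆⁆⁆⁆⁆,
    ⁅genB, ⁅genB, ⁅genA, ⁅genA, ⁅genA, ⁅genA, genB⁆⁆⁆⁆⁆⁆,
    ⁅genA, ⁅genA, ⁅genA, ⁅genB, ⁅genB, ⁅genA, genB⁆⁆⁆⁆⁆⁆,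
    ⁅genA, ⁅genB, ⁅genB, ⁅genA, ⁅genA, ⁅genA, genB⁆⁆⁆⁆⁆⁆,
    ⁅genA, ⁅genB, ⁅genA, ⁅genB, ⁅genA, ⁅genA, genB⁆⁆⁆⁆⁆⁆} := by
  refine S_le S_3_3 S_4_2 ?_ ?_
  · simp only [Set.mem_insert_iff, Set.mem_singleton_iff, forall_eq_or_imp, forall_eq]
    refine ⟨?_, ?_, ?_⟩
    · exact Submodule.subset_span (by simp)
    · exact Submodule.subset_span (by simp)
    · exact Submodule.subset_span (by simp)
  · simp only [Set.mem_insert_iff, Set.mem_singleton_iff, forall_eq_or_imp, forall_eq]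
    refine ⟨?_, ?_⟩
    · exact Submodule.subset_span (by simp)
    · exact Submodule.subset_span (by simp)

theorem S_4_4 : S 4 4 ≤ Submodule.span ℂ {⁅genB, ⁅genA, ⁅genB, ⁅genA, ⁅genB, ⁅genA, ⁅genA, genB⁆⁆⁆⁆⁆⁆⁆,
    ⁅genB, ⁅genA, ⁅genB, ⁅genB, ⁅genA, ⁅genA, ⁅genA, genB⁆⁆⁆⁆⁆⁆⁆,
    ⁅genB, ⁅genA, ⁅genA, ⁅genA, ⁅genB, ⁅genB, ⁅genA, genB⁆⁆⁆⁆⁆⁆⁆,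
    ⁅genB, ⁅genB, ⁅genB, ⁅genA, ⁅genA, ⁅genA, ⁅genA, genB⁆⁆⁆⁆⁆⁆⁆,
    ⁅genB, ⁅genB, ⁅genA, ⁅genA, ⁅genB, ⁅genA, ⁅genA, genB⁆⁆⁆⁆⁆⁆⁆,
    ⁅genA, ⁅genA, ⁅genB, ⁅genA, ⁅genB, ⁅genB, ⁅genA, genB⁆⁆⁆⁆⁆⁆⁆,
    ⁅genA, ⁅genA, ⁅genB, ⁅genB, ⁅genB, ⁅genA, ⁅genA, genB⁆⁆⁆⁆⁆⁆⁆,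
    ⁅genA, ⁅genB, ⁅genB, ⁅genA, ⁅genB, ⁅genA, ⁅genA, genB⁆⁆⁆⁆⁆⁆⁆} := by
  refine S_le S_3_4 S_4_3 ?_ ?_
  · simp only [Set.mem_insert_iff, Set.mem_singleton_iff, forall_eq_or_imp, forall_eq]
    refine ⟨?_, ?_, ?_, ?_, ?_⟩
    · rw [r44b]
      repeat' first | apply Submodule.add_mem | apply Submodule.smul_mem
      all_goals exact Submodule.subset_span (by simp)
    · rw [r44a]
      repeat' first | apply Submodule.add_mem | apply Submodule.smul_mem
      all_goals exact Submodule.subset_span (by simp)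
    · exact Submodule.subset_span (by simp)
    · exact Submodule.subset_span (by simp)
    · exact Submodule.subset_span (by simp)
  · simp only [Set.mem_insert_iff, Set.mem_singleton_iff, forall_eq_or_imp, forall_eq]
    refine ⟨?_, ?_, ?_, ?_, ?_⟩
    · exact Submodule.subset_span (by simp)
    · exact Submodule.subset_span (by simp)
    · exact Submodule.subset_span (by simp)
    · exact Submodule.subset_span (by simp)
    · exact Submodule.subset_span (by simp)

end Spanning

section Functionals

attribute [local instance] LieRing.ofAssociativeRing

/-- Right-normed words. -/
def rnw : List (Fin 2) → FL
  | [] => 0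
  | [i] => FreeLieAlgebra.of ℂ i
  | i :: j :: l => ⁅FreeLieAlgebra.of ℂ i, rnw (j :: l)⁆

/-- Left concatenation of the letter `i`, on (noncommutative) integer power series. -/
def la (i : Fin 2) (f : List (Fin 2) → ℤ) : List (Fin 2) → ℤ
  | [] => 0
  | j :: v => if i = j then f v else 0

/-- Left multiplication by the right-normed word `w`, on integer power series. -/
def op : List (Fin 2) → (List (Fin 2) → ℤ) → List (Fin 2) → ℤ
  | [], _ => fun _ => 0
  | [i], f => la i f
  | i :: j :: l, f => fun v => la i (op (j :: l) f) v - op (j :: l) (la i f) v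

/-- Left multiplication by `x.w`, for `w` a right-normed word, on integer power series. -/
def dop : List (Fin 2) → (List (Fin 2) → ℤ) → List (Fin 2) → ℤ
  | [], _ => fun _ => 0
  | [i], f => if i = 1 then la 0 f else fun _ => 0
  | i :: j :: l, f => fun v =>
      (if i = 1 then la 0 (op (j :: l) f) v - op (j :: l) (la 0 f) v else 0) +
      (la i (dop (j :: l) f) v - dop (j :: l) (la i f) v)

/-- The power series `1`. -/
def dl : List (Fin 2) → ℤ
  | [] => 1
  | _ :: _ => 0

/-- Left concatenation of the letter `i`, on complex power series. -/
def laC (i : Fin 2) : Module.End ℂ (List (Fin 2) → ℂ) where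
  toFun f v := match v with
    | [] => 0
    | j :: v => if i = j then f v else 0
  map_add' f g := by
    ext v
    cases v with
    | nil => simp
    | cons j v => by_cases h : i = j <;> simp [h]
  map_smul' c f := by
    ext v
    cases v with
    | nil => simp
    | cons j v => by_cases h : i = j <;> simp [h]

/-- The left regular representation of `FL` on power series. -/
def rep : FL →ₗ⁅ℂ⁆ Module.End ℂ (List (Fin 2) → ℂ) := FreeLieAlgebra.lift ℂ laC

/-- Coefficientwise cast. -/
def cst (f : List (Fin 2) → ℤ) : List (Fin 2) → ℂ := fun v => (f v : ℂ)

theorem laC_cst (i : Fin 2) (f : List (Fin 2) → ℤ) : laC i (cst f) = cst (la i f) := by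
  ext v
  cases v with
  | nil => simp [laC, cst, la]
  | cons j v => by_cases h : i = j <;> simp [laC, cst, la, h]

theorem rep_of (i : Fin 2) (f : List (Fin 2) → ℤ) :
    rep (FreeLieAlgebra.of ℂ i) (cst f) = cst (la i f) := by
  rw [rep, FreeLieAlgebra.lift_of_apply, laC_cst]

theorem rep_lie (u v : FL) (f : List (Fin 2) → ℂ) :
    rep ⁅u, v⁆ f = rep u (rep v f) - rep v (rep u f) := by
  rw [LieHom.map_lie]
  rfl

theorem cst_sub (f g : List (Fin 2) → ℤ) : cst f - cst g = cst (fun v => f v - g v) := by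
  ext v
  simp [cst]

theorem cst_add (f g : List (Fin 2) → ℤ) : cst f + cst g = cst (fun v => f v + g v) := by
  ext v
  simp [cst]

theorem cst_zero : cst (fun _ => 0) = 0 := by
  ext v
  simp [cst]

theorem rep_rnw (w : List (Fin 2)) : ∀ f : List (Fin 2) → ℤ,
    rep (rnw w) (cst f) = cst (op w f) := by
  induction w using rnw.induct with
  | case1 => intro f; simp [rnw, op, cst_zero]
  | case2 i => intro f; rw [rnw, op, rep_of]
  | case3 i j l ih =>
    intro f
    rw [rnw, op, rep_lie, ih, rep_of, rep_of, ih, cst_sub]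

theorem rep_X_rnw (X : LieDerivation ℂ FL FL) (hXa : X genA = 0) (hXb : X genB = genA)
    (w : List (Fin 2)) : ∀ f : List (Fin 2) → ℤ,
    rep (X (rnw w)) (cst f) = cst (dop w f) := by
  have h0 : X (FreeLieAlgebra.of ℂ 0) = 0 := hXa
  have h1 : X (FreeLieAlgebra.of ℂ 1) = FreeLieAlgebra.of ℂ 0 := hXb
  induction w using rnw.induct with
  | case1 => intro f; simp [rnw, dop, cst_zero]
  | case2 i =>
    intro f
    fin_cases i
    · simp [rnw, dop, h0, cst_zero]
    · simp [rnw, dop, h1, rep_of]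
  | case3 i j l ih =>
    intro f
    rw [rnw, dop, LieDerivation.apply_lie_eq_add, map_add, LinearMap.add_apply, rep_lie, rep_lie,
      ih, rep_of, rep_of, ih, rep_rnw, cst_sub, add_comm]
    fin_cases i
    · simp [h0, cst_zero]
    · simp only [Fin.mk_one, h1, rep_of, rep_rnw, cst_sub, cst_add, if_true]

/-- The words indexing the basis of the multidegree (4,4) component. -/
def W : Fin 8 → List (Fin 2) := ![
  [1, 0, 1, 0, 1, 0, 0, 1],
  [1, 0, 1, 1, 0, 0, 0, 1],
  [1, 0, 0, 0, 1, 1, 0, 1],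
  [1, 1, 1, 0, 0, 0, 0, 1],
  [1, 1, 0, 0, 1, 0, 0, 1],
  [0, 0, 1, 0, 1, 1, 0, 1],
  [0, 0, 1, 1, 1, 0, 0, 1],
  [0, 1, 1, 0, 1, 0, 0, 1]]

theorem coeff_X (X : LieDerivation ℂ FL FL) (hXa : X genA = 0) (hXb : X genB = genA)
    (c : Fin 8 → ℂ) (hX : X (∑ i, c i • rnw (W i)) = 0) (v : List (Fin 2)) (T : Fin 8 → ℤ)
    (hT : ∀ i, dop (W i) dl v = T i) : ∑ i, c i * (T i : ℂ) = 0 := by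
  have h : rep (X (∑ i, c i • rnw (W i))) (cst dl) v = 0 := by
    rw [hX]
    simp
  simp only [map_sum, map_smul, LinearMap.sum_apply, LinearMap.smul_apply,
    rep_X_rnw X hXa hXb, Finset.sum_apply, Pi.smul_apply, smul_eq_mul] at h
  rw [← h]
  refine Finset.sum_congr rfl fun i _ => ?_
  rw [← hT, cst]

theorem coeff_W (c : Fin 8 → ℂ) (v : List (Fin 2)) (T : Fin 8 → ℤ)
    (hT : ∀ i, op (W i) dl v = T i) :
    rep (∑ i, c i • rnw (W i)) (cst dl) v = ∑ i, c i * (T i : ℂ) := by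
  simp only [map_sum, map_smul, LinearMap.sum_apply, LinearMap.smul_apply,
    rep_rnw, Finset.sum_apply, Pi.smul_apply, smul_eq_mul]
  refine Finset.sum_congr rfl fun i _ => ?_
  rw [← hT, cst]

theorem X_kernel (X : LieDerivation ℂ FL FL) (hXa : X genA = 0) (hXb : X genB = genA)
    (c : Fin 8 → ℂ) (hX : X (∑ i, c i • rnw (W i)) = 0) :
    c 0 = -1 * c 7 ∧ c 1 = (1/3) * c 7 ∧ c 2 = (-1/3) * c 7 ∧ c 3 = (-1/2) * c 7 ∧ c 4 = 1 * c 7 ∧ c 5 = 1 * c 7 ∧ c 6 = (-3/2) * c 7 := by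
  have e0 := coeff_X X hXa hXb c hX [0, 0, 0, 0, 0, 1, 1, 1]
    ![3, 3, 3, 3, 3, 3, 3, 3] (by decide +kernel)
  have e1 := coeff_X X hXa hXb c hX [0, 0, 0, 0, 1, 0, 1, 1]
    ![-8, -10, -7, -13, -9, -7, -7, -8] (by decide +kernel)
  have e2 := coeff_X X hXa hXb c hX [0, 0, 0, 0, 1, 1, 0, 1]
    ![-5, -3, -3, -1, -5, 1, -1, -3] (by decide +kernel)
  have e3 := coeff_X X hXa hXb c hX [0, 0, 0, 1, 0, 0, 1, 1]
    ![6, 12, 0, 22, 10, 0, 2, 6] (by decide +kernel)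
  have e4 := coeff_X X hXa hXb c hX [0, 0, 0, 1, 0, 1, 0, 1]
    ![16, 10, 16, 4, 14, 8, 8, 10] (by decide +kernel)
  have e5 := coeff_X X hXa hXb c hX [0, 0, 0, 1, 1, 0, 0, 1]
    ![1, 1, 4, 0, 2, -2, -2, -1] (by decide +kernel)
  have e6 := coeff_X X hXa hXb c hX [0, 0, 1, 0, 0, 1, 0, 1]
    ![-4, -3, 0, -6, 0, 4, 8, 2] (by decide +kernel)
  simp only [Fin.sum_univ_eight, Matrix.cons_val] at e0 e1 e2 e3 e4 e5 e6
  push_cast at e0 e1 e2 e3 e4 e5 e6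
  refine ⟨?_, ?_, ?_, ?_, ?_, ?_, ?_⟩
  · linear_combination (133/3) * e0 + (17) * e1 + (2) * e2 + (4) * e3 + (-1) * e4 + (2) * e5 + (-1) * e6
  · linear_combination (-1621/18) * e0 + (-107/3) * e1 + (-11/2) * e2 + (-53/6) * e3 + (4/3) * e4 + (-13/3) * e5 + (5/3) * e6
  · linear_combination (290/9) * e0 + (73/6) * e1 + (3/2) * e2 + (17/6) * e3 + (-5/6) * e4 + (11/6) * e5 + (-2/3) * e6
  · linear_combination (201/4) * e0 + (39/2) * e1 + (11/4) * e2 + (19/4) * e3 + (-1) * e4 + (5/2) * e5 + (-1) * e6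
  · linear_combination (-39) * e0 + (-14) * e1 + (-1) * e2 + (-3) * e3 + (3/2) * e4 + (-2) * e5 + (1) * e6
  · linear_combination (-47) * e0 + (-35/2) * e1 + (-3/2) * e2 + (-4) * e3 + (3/2) * e4 + (-5/2) * e5 + (1) * e6
  · linear_combination (595/12) * e0 + (37/2) * e1 + (7/4) * e2 + (17/4) * e3 + (-3/2) * e4 + (5/2) * e5 + (-1) * e6

theorem E8_bracket : E8 = ⁅ba, ⁅bab, baa⁆⁆ := e8_bracket ba baa bab

theorem E8_expand : E8 = ∑ i, (![-1/4, 1/12, -1/12, -1/8, 1/4, 1/4, -3/8, 1/4] : Fin 8 → ℂ) i •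
    rnw (W i) := by
  rw [E8_bracket]
  simp only [Fin.sum_univ_eight, Matrix.cons_val, W, rnw]
  exact e8_expand genA genB

theorem E8_ne : E8 ≠ 0 := by
  intro h
  have h2 := coeff_W ![-1/4, 1/12, -1/12, -1/8, 1/4, 1/4, -3/8, 1/4] [0, 0, 1, 0, 1, 1, 0, 1]
    ![-2, -3, -9, 0, 0, 0, 0, 0] (by decide +kernel)
  rw [← E8_expand, h] at h2
  simp only [Fin.sum_univ_eight, Matrix.cons_val] at h2
  norm_num at h2

end Functionals

theorem homog_eight (H : LieDerivation ℂ FL FL) (hHa : H genA = genA) (hHb : H genB = -genB)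
    (Z : FL) (hZ : Z ∈ homog 8) (hH : H Z = 0) : Z ∈ S 4 4 := by
  let P : Polynomial ℂ := (Polynomial.X ^ 2 - Polynomial.C 4) * (Polynomial.X ^ 2 - Polynomial.C 16) *
    (Polynomial.X ^ 2 - Polynomial.C 36) * (Polynomial.X ^ 2 - Polynomial.C 64)
  have key : ∀ (μ : ℂ) (z : FL), H z = μ • z →
      Polynomial.aeval H.toLinearMap P z = P.eval μ • z := by
    intro μ z hz
    by_cases h0 : z = 0
    · simp [h0]
    · exact Module.End.aeval_apply_of_hasEigenvector
        ⟨Module.End.mem_eigenspace_iff.mpr hz, h0⟩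
  have hle : homog 8 ≤ (S 4 4).comap (Polynomial.aeval H.toLinearMap P) := by
    rw [homog, Submodule.span_le]
    rintro _ ⟨t, ht, rfl⟩
    have hS := S_magma t
    have hsum := ca_add_cb t
    rw [show t.length = 8 from ht] at hsum
    have hev := key _ _ (S_eigen H hHa hHb _ _ _ hS)
    rw [SetLike.mem_coe, Submodule.mem_comap, hev]
    by_cases h4 : ca t = 4
    · have h4' : cb t = 4 := by lia
      rw [h4, h4'] at hS
      exact Submodule.smul_mem _ _ hS
    · have hz : P.eval ((ca t : ℂ) - (cb t : ℂ)) = 0 := by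
        have h1 : ca t ≤ 8 := by lia
        have h2 : cb t = 8 - ca t := by lia
        rw [h2]
        generalize ca t = n at *
        interval_cases n <;> first | exact absurd rfl h4 | norm_num [P]
      rw [hz, zero_smul]
      exact Submodule.zero_mem _
  have h := hle hZ
  rw [Submodule.mem_comap, key 0 Z (by rw [hH, zero_smul])] at h
  have hP : P.eval 0 ≠ 0 := by norm_num [P]
  exact (Submodule.smul_mem_iff _ hP).mp h

theorem S44_sum (Z : FL) (hZ : Z ∈ S 4 4) : ∃ c : Fin 8 → ℂ, Z = ∑ i, c i • rnw (W i) := by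
  have h := S_4_4 hZ
  simp only [Submodule.mem_span_insert, Submodule.mem_span_singleton] at h
  obtain ⟨c0, _, ⟨c1, _, ⟨c2, _, ⟨c3, _, ⟨c4, _, ⟨c5, _, ⟨c6, _, ⟨c7, rfl⟩, rfl⟩, rfl⟩, rfl⟩,
    rfl⟩, rfl⟩, rfl⟩, rfl⟩ := h
  refine ⟨![c0, c1, c2, c3, c4, c5, c6, c7], ?_⟩
  simp only [Fin.sum_univ_eight, Matrix.cons_val, W, rnw, genA, genB]
  module

theorem lie_mem_homog (t u : FreeMagma (Fin 2)) (n : ℕ) (h : (t * u).length = n) :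
    ⁅magmaToLie t, magmaToLie u⁆ ∈ homog n :=
  Submodule.subset_span ⟨t * u, h, rfl⟩

/-- The nonassociative words behind `ba`, `baa`, `bab`. -/
def tba : FreeMagma (Fin 2) := .mul (.of 1) (.of 0)
/-- word of `baa` -/
def tbaa : FreeMagma (Fin 2) := .mul tba (.of 0)
/-- word of `bab` -/
def tbab : FreeMagma (Fin 2) := .mul tba (.of 1)

theorem mem_inv (X H Y : LieDerivation ℂ FL FL) (j : ℕ) (Z : FL) : Z ∈ invariants X H Y j ↔
    Z ∈ homog j ∧ X Z = 0 ∧ H Z = 0 ∧ Y Z = 0 := by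
  simp only [invariants, Submodule.mem_inf, LinearMap.mem_ker, and_assoc]
  rfl

end Deg8

open Deg8
/-- For the natural representation of sl₂(ℂ) on the free Lie algebra on `a, b`, the
space of Lie invariants of degree 8 is one-dimensional, spanned by
`[[[[b,a],a],[b,a]],[[b,a],b]] − [[[[b,a],b],[b,a]],[[b,a],a]]`, which equals the
bracket `[I₂, I₆] = [[b,a], [[[b,a],b],[[b,a],a]]]`; consequently there are no
primitive invariants in degree 8. -/
theorem invariants_degree_eight
    (X H Y : LieDerivation ℂ FL FL)
    (hXa : X genA = 0) (hXb : X genB = genA)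
    (hHa : H genA = genA) (hHb : H genB = -genB)
    (hYa : Y genA = genB) (hYb : Y genB = 0) :
    invariants X H Y 8 = Submodule.span ℂ {E8} ∧ E8 ≠ (0 : FL) ∧
    E8 = ⁅ba, ⁅bab, baa⁆⁆ ∧
    (∀ Z ∈ invariants X H Y 8, Z ∈ lowerInv X H Y 8) := by
  have hX1 : X ba = 0 := by simp [ba, LieDerivation.apply_lie_eq_add, hXa, hXb]
  have hH1 : H ba = 0 := by simp [ba, LieDerivation.apply_lie_eq_add, hHa, hHb]
  have hY1 : Y ba = 0 := by simp [ba, LieDerivation.apply_lie_eq_add, hYa, hYb]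
  have hXbaa : X baa = 0 := by
    rw [baa, LieDerivation.apply_lie_eq_add, hXa, hX1, lie_zero, zero_lie, add_zero]
  have hXbab : X bab = baa := by
    rw [bab, LieDerivation.apply_lie_eq_add, hXb, hX1, zero_lie, add_zero, baa]
  have hHbaa : H baa = baa := by
    rw [baa, LieDerivation.apply_lie_eq_add, hHa, hH1, zero_lie, add_zero]
  have hHbab : H bab = -bab := by
    rw [bab, LieDerivation.apply_lie_eq_add, hHb, hH1, zero_lie, add_zero, lie_neg]
  have hYbaa : Y baa = bab := by
    rw [baa, LieDerivation.apply_lie_eq_add, hYa, hY1, zero_lie, add_zero, bab]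
  have hYbab : Y bab = 0 := by
    rw [bab, LieDerivation.apply_lie_eq_add, hYb, hY1, lie_zero, zero_lie, add_zero]
  have hX2 : X ⁅bab, baa⁆ = 0 := by
    rw [LieDerivation.apply_lie_eq_add, hXbaa, hXbab, lie_zero, lie_self, add_zero]
  have hH2 : H ⁅bab, baa⁆ = 0 := by
    rw [LieDerivation.apply_lie_eq_add, hHbaa, hHbab, neg_lie, add_neg_cancel]
  have hY2 : Y ⁅bab, baa⁆ = 0 := by
    rw [LieDerivation.apply_lie_eq_add, hYbaa, hYbab, zero_lie, lie_self, add_zero]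
  have i2 : ba ∈ invariants X H Y 2 :=
    (mem_inv X H Y 2 _).mpr ⟨lie_mem_homog (.of 1) (.of 0) 2 rfl, hX1, hH1, hY1⟩
  have i6 : ⁅bab, baa⁆ ∈ invariants X H Y 6 :=
    (mem_inv X H Y 6 _).mpr ⟨lie_mem_homog tbab tbaa 6 rfl, hX2, hH2, hY2⟩
  have i8 : E8 ∈ invariants X H Y 8 := by
    rw [E8_bracket]
    refine (mem_inv X H Y 8 _).mpr ⟨lie_mem_homog tba (.mul tbab tbaa) 8 rfl, ?_, ?_, ?_⟩
    · rw [LieDerivation.apply_lie_eq_add, hX1, hX2, lie_zero, zero_lie, add_zero]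
    · rw [LieDerivation.apply_lie_eq_add, hH1, hH2, lie_zero, zero_lie, add_zero]
    · rw [LieDerivation.apply_lie_eq_add, hY1, hY2, lie_zero, zero_lie, add_zero]
  have hinv : invariants X H Y 8 = Submodule.span ℂ {E8} := by
    refine le_antisymm ?_ ?_
    · intro Z hZ
      obtain ⟨hh, hX, hH, -⟩ := (mem_inv X H Y 8 Z).mp hZ
      obtain ⟨c, rfl⟩ := S44_sum Z (homog_eight H hHa hHb Z hh hH)
      obtain ⟨h0, h1, h2, h3, h4, h5, h6⟩ := X_kernel X hXa hXb c hX
      refine Submodule.mem_span_singleton.mpr ⟨4 * c 7, ?_⟩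
      rw [E8_expand]
      simp only [Fin.sum_univ_eight, Matrix.cons_val, h0, h1, h2, h3, h4, h5, h6]
      module
    · rw [Submodule.span_singleton_le_iff_mem]
      exact i8
  refine ⟨hinv, E8_ne, E8_bracket, ?_⟩
  intro Z hZ
  rw [hinv] at hZ
  obtain ⟨c, rfl⟩ := Submodule.mem_span_singleton.mp hZ
  rw [E8_bracket]
  refine (lowerInv X H Y 8).smul_mem c ((lowerInv X H Y 8).lie_mem ?_ ?_)
  · exact LieSubalgebra.subset_lieSpan
      (Set.mem_iUnion₂.mpr ⟨2, by norm_num, i2⟩)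
  · exact LieSubalgebra.subset_lieSpan
      (Set.mem_iUnion₂.mpr ⟨6, by norm_num, i6⟩)
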